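/- arXiv:2510.14568 — 2 statements merged into one kernel-verified Lean document; each statement's English description precedes it below -/
import Mathlib

section
/- Let G be a finite group and let F be an injective group cellular automaton on G that is expansive, with expansivity constant k_F, and let ρ(F^{−1}) be a radius of the inverse CA F^{−1}. Let c ∈ L(k) and n ∈ ℕ. If pos(F^{−n}(c)) > k + k_F·ρ(F^{−1}), then F^{−n}(c) is not a lower angular configuration for F. -/
open Function Topology

/-- The prodiscrete (product of discrete) topology on configurations `ℤ → A`. -/
def configTop (A : Type*) : TopologicalSpace (ℤ → A) :=
  @Pi.topologicalSpace ℤ (fun _ => A) (fun _ => ⊥)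

/-- The shift map. -/
def shiftMap (A : Type*) : (ℤ → A) → (ℤ → A) := fun c i => c (i + 1)

open Classical in
/-- The Tychonoff distance on configurations. -/
noncomputable def tychDist {A : Type*} (c c' : ℤ → A) : ℝ :=
  if c = c' then 0
  else (2 : ℝ) ^ (-((sInf {n : ℕ | ∃ j : ℤ, j.natAbs = n ∧ c j ≠ c' j} : ℕ) : ℤ))

/-- The `n`-th iterate, `n ∈ ℤ`, of a map (negative powers via `Function.invFun`,
which is the genuine inverse whenever the map is bijective). -/
noncomputable def zIter {A : Type*} [Nonempty A] (F : (ℤ → A) → (ℤ → A)) (n : ℤ) :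
    (ℤ → A) → (ℤ → A) :=
  if 0 ≤ n then F^[n.toNat] else (Function.invFun F)^[(-n).toNat]

/-- Expansivity (for reversible maps). -/
def Expansive {A : Type*} [Nonempty A] (F : (ℤ → A) → (ℤ → A)) : Prop :=
  ∃ ε : ℝ, 0 < ε ∧ ∀ c c' : ℤ → A, c ≠ c' →
    ∃ n : ℤ, tychDist (zIter F n c) (zIter F n c') > ε

/-- Positive expansivity. -/
def PosExpansive {A : Type*} (F : (ℤ → A) → (ℤ → A)) : Prop :=
  ∃ ε : ℝ, 0 < ε ∧ ∀ c c' : ℤ → A, c ≠ c' →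
    ∃ n : ℕ, tychDist (F^[n] c) (F^[n] c') > ε

/-- Topological transitivity (w.r.t. the prodiscrete topology). -/
def TopTransitive {A : Type*} (F : (ℤ → A) → (ℤ → A)) : Prop :=
  ∀ U V : Set (ℤ → A), IsOpen[configTop A] U → IsOpen[configTop A] V →
    U.Nonempty → V.Nonempty → ∃ n : ℕ, (F^[n] '' U ∩ V).Nonempty

/-- Left fronts. -/
def Lset (G : Type*) [One G] (k : ℤ) : Set (ℤ → G) := {c | c k ≠ 1 ∧ ∀ i > k, c i = 1}

/-- Right fronts. -/
def Rset (G : Type*) [One G] (k : ℤ) : Set (ℤ → G) := {c | c k ≠ 1 ∧ ∀ i < k, c i = 1}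

/-- The position of a front: the largest index where it differs from the identity. -/
noncomputable def pos {G : Type*} [One G] (c : ℤ → G) : ℤ := sSup {j : ℤ | c j ≠ 1}

/-- `kF` is an expansivity constant for `F`. -/
def ExpConstant {G : Type*} [Group G] (F : (ℤ → G) → (ℤ → G)) (kF : ℕ) : Prop :=
  0 < kF ∧ ∀ k : ℤ,
    (∀ c ∈ Lset G k, ∃ n : ℤ, n.natAbs ≤ kF ∧ pos (zIter F n c) > k) ∧
    (∀ c ∈ Rset G k, ∃ n : ℤ, n.natAbs ≤ kF ∧ ∃ j < k, zIter F n c j ≠ 1)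

/-- `ρ` is a radius of `F`. -/
def IsRadius {A : Type*} (F : (ℤ → A) → (ℤ → A)) (ρ : ℕ) : Prop :=
  ∀ c c' : ℤ → A, ∀ i : ℤ, (∀ j : ℤ, |j - i| ≤ (ρ : ℤ) → c j = c' j) → F c i = F c' i

theorem apply_comp_add_natCast {A : Type*} {F : (ℤ → A) → (ℤ → A)}
    (hshift : F ∘ shiftMap A = shiftMap A ∘ F) (p : ℕ) (c : ℤ → A) :
    F (fun i => c (i + p)) = fun i => F c (i + p) := by
  induction p with
  | zero => simp
  | succ p ih =>
    have h := congrFun hshift (fun i => c (i + p))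
    simp only [comp_apply, ih] at h
    simp only [Nat.cast_add, Nat.cast_one, add_comm (p : ℤ) 1, ← add_assoc]
    exact h

theorem Function.Periodic.mem_range_of_injective {A : Type*} [Finite A] {F : (ℤ → A) → (ℤ → A)}
    (hshift : F ∘ shiftMap A = shiftMap A ∘ F) (hinj : Injective F) {p : ℕ} (hp : 0 < p)
    {y : ℤ → A} (hy : Periodic y (p : ℤ)) : y ∈ Set.range F := by
  let S := {z : ℤ → A // Periodic z (p : ℤ)}
  have : Finite S := by
    refine Finite.of_injective (β := Set.Ico (0 : ℤ) p → A) (fun z i => z.1 i) fun z w h => ?_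
    refine Subtype.ext (funext fun i => ?_)
    have hp' : (0 : ℤ) < p := by exact_mod_cast hp
    have := congrFun h ⟨i % p, Int.emod_nonneg _ hp'.ne', Int.emod_lt_of_pos _ hp'⟩
    have key : ∀ u : S, u.1 (i % p) = u.1 i := fun u => by
      have h1 := u.2.sub_int_mul_eq (x := i) (i / p)
      rw [← h1, Int.emod_def, mul_comm]
      rfl
    rw [← key z, ← key w]
    exact this
  let T : S → S := fun z => ⟨F z.1, fun i => by
    have h := congrFun (apply_comp_add_natCast hshift p z.1) i
    rw [funext z.2] at h
    exact h.symm⟩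
  have hT : Injective T := fun z w h => Subtype.ext (hinj (congrArg Subtype.val h))
  obtain ⟨z, hz⟩ := (Finite.injective_iff_surjective.1 hT) ⟨y, hy⟩
  exact ⟨z.1, congrArg Subtype.val hz⟩

/-- An injective cellular automaton over a finite alphabet is surjective. -/
theorem surjective_of_injective_of_shift {A : Type*} [Finite A] {F : (ℤ → A) → (ℤ → A)}
    (hcont : Continuous[configTop A, configTop A] F)
    (hshift : F ∘ shiftMap A = shiftMap A ∘ F) (hinj : Injective F) : Surjective F := by
  let : TopologicalSpace A := ⊥
  have : DiscreteTopology A := ⟨rfl⟩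
  have hcont' : Continuous F := hcont
  have hclosed : IsClosed (Set.range F) := (isCompact_range hcont').isClosed
  intro y
  let a : ℕ → ℤ → A := fun N i => y ((i + N) % ((2 * N + 1 : ℕ) : ℤ) - N)
  have ha : Filter.Tendsto a Filter.atTop (𝓝 y) := by
    rw [tendsto_pi_nhds]
    intro i
    refine tendsto_const_nhds.congr' ?_
    filter_upwards [Filter.eventually_ge_atTop i.natAbs] with N hN
    simp only [a]
    rw [Int.emod_eq_of_lt (by omega) (by omega), add_sub_cancel_right]
  refine hclosed.mem_of_tendsto ha (Filter.Eventually.of_forall fun N => ?_)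
  refine Periodic.mem_range_of_injective hshift hinj (p := 2 * N + 1) (by omega) fun i => ?_
  simp only [a]
  rw [add_right_comm, Int.add_emod_right]

theorem zIter_ofBijective {A : Type*} [Nonempty A] {F : (ℤ → A) → (ℤ → A)} (hF : Bijective F)
    (n : ℤ) : zIter F n = ⇑((Equiv.ofBijective F hF : Equiv.Perm (ℤ → A)) ^ n) := by
  have hinv : invFun F = ⇑(Equiv.ofBijective F hF : Equiv.Perm (ℤ → A))⁻¹ := by
    funext x
    apply hF.1
    rw [rightInverse_invFun hF.2 x]
    exact ((Equiv.ofBijective F hF).apply_symm_apply x).symm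
  unfold zIter
  split_ifs with h
  · obtain ⟨m, rfl⟩ := Int.eq_ofNat_of_zero_le h
    simp [Equiv.Perm.coe_pow]
  · obtain ⟨m, hm⟩ := Int.eq_ofNat_of_zero_le (show 0 ≤ -n by omega)
    obtain rfl : n = -(m : ℤ) := by omega
    rw [hinv, zpow_neg, zpow_natCast, ← inv_pow, Equiv.Perm.coe_pow]
    simp

theorem zIter_add {A : Type*} [Nonempty A] {F : (ℤ → A) → (ℤ → A)} (hF : Bijective F)
    (m n : ℤ) (c : ℤ → A) : zIter F m (zIter F n c) = zIter F (m + n) c := by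
  simp only [zIter_ofBijective hF, zpow_add, Equiv.Perm.mul_apply]

theorem pos_le {G : Type*} [One G] {c : ℤ → G} (hc : c ≠ 1) {m : ℤ} (hm : ∀ j > m, c j = 1) :
    pos c ≤ m :=
  csSup_le (ne_iff.1 hc) fun j hj => not_lt.1 fun h => hj (hm j h)

theorem mem_Lset_pos {G : Type*} [One G] {c : ℤ → G} (hc : c ≠ 1) {m : ℤ}
    (hm : ∀ j > m, c j = 1) : c ∈ Lset G (pos c) := by
  have hb : BddAbove {j : ℤ | c j ≠ 1} := ⟨m, fun j hj => not_lt.1 fun h => hj (hm j h)⟩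
  refine ⟨Int.csSup_mem (ne_iff.1 hc) hb, fun j hj => ?_⟩
  by_contra h
  exact absurd (le_csSup hb h) (not_le.2 hj)

theorem ne_one_of_mem_Lset {G : Type*} [One G] {c : ℤ → G} {k : ℤ} (hc : c ∈ Lset G k) : c ≠ 1 :=
  fun h => hc.1 (congrFun h k)

theorem le_pos_of_mem_Lset {G : Type*} [One G] {c : ℤ → G} {k : ℤ} (hc : c ∈ Lset G k) :
    k ≤ pos c :=
  not_lt.1 fun h => hc.1 ((mem_Lset_pos (ne_one_of_mem_Lset hc) hc.2).2 k h)

theorem IsRadius.iterate_eq_one {G : Type*} [One G] {F : (ℤ → G) → (ℤ → G)} {ρ : ℕ}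
    (hρ : IsRadius F ρ) (hF : F 1 = 1) {c : ℤ → G} {k : ℤ} (hc : ∀ j > k, c j = 1) (m : ℕ) :
    ∀ j > k + m * ρ, F^[m] c j = 1 := by
  induction m with
  | zero => simpa using hc
  | succ m ih =>
    intro j hj
    rw [iterate_succ_apply']
    refine (hρ _ 1 _ fun i hi => ih i ?_).trans (congrFun hF j)
    have := (abs_le.1 hi).1
    push_cast at hj
    linarith

/-- if the position of a left front after `n` backward iterations exceeds
`k + k_F · ρ(F⁻¹)`, then `F^{-n}(c)` is not a lower angular configuration. -/
theorem not_lowerAngular_of_pos_large {G : Type*} [Group G] [Fintype G]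
    (F : (ℤ → G) → (ℤ → G))
    (hcont : Continuous[configTop G, configTop G] F)
    (hshift : F ∘ shiftMap G = shiftMap G ∘ F)
    (hhom : ∀ c c' : ℤ → G, F (c * c') = F c * F c')
    (hinj : Function.Injective F)
    (hexp : Expansive F) (kF : ℕ) (hkF : ExpConstant F kF)
    (ρ : ℕ) (hρ : IsRadius (Function.invFun F) ρ)
    (k : ℤ) (c : ℤ → G) (hc : c ∈ Lset G k) (n : ℕ)
    (hpos : pos (zIter F (-(n : ℤ)) c) > k + (kF : ℤ) * (ρ : ℤ)) :
    ¬ ∃ k' : ℤ, zIter F (-(n : ℤ)) c ∈ Lset G k' ∧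
        ∀ i : ℕ, i ≤ kF → ∀ j > k', zIter F (-(i : ℤ)) (zIter F (-(n : ℤ)) c) j = 1 := by
  rintro ⟨k', hd, hlow⟩
  have hF : Bijective F := ⟨hinj, surjective_of_injective_of_shift hcont hshift hinj⟩
  have hF1 : F 1 = 1 := by simpa using hhom 1 1
  have hI1 : invFun F 1 = 1 := by
    apply hinj
    rw [rightInverse_invFun hF.2, hF1]
  have hsupp : ∀ m : ℕ, ∀ j > k + m * ρ, zIter F (-(m : ℤ)) c j = 1 := by
    intro m
    have : zIter F (-(m : ℤ)) c = (invFun F)^[m] c := by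
      rcases m.eq_zero_or_pos with rfl | hm
      · simp [zIter]
      · rw [zIter, if_neg (by omega), neg_neg, Int.toNat_natCast]
    rw [this]
    exact hρ.iterate_eq_one hI1 hc.2 m
  have hne : ∀ m : ℤ, zIter F m c ≠ 1 := by
    intro m h
    have h1 : zIter F m (1 : ℤ → G) = 1 := by
      rw [zIter]
      split_ifs
      · exact iterate_fixed hF1 _
      · exact iterate_fixed hI1 _
    rw [← h1, zIter_ofBijective hF] at h
    exact ne_one_of_mem_Lset hc (Equiv.injective _ h)
  have hk' : pos (zIter F (-(n : ℤ)) c) ≤ k' := pos_le (hne _) hd.2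
  obtain ⟨m, hm, hmax⟩ := Finset.exists_max_image (Finset.range (n + 1))
    (fun m : ℕ => pos (zIter F (-(m : ℤ)) c)) ⟨n, by simp⟩
  have hM : k' ≤ pos (zIter F (-(m : ℤ)) c) := (le_pos_of_mem_Lset hd).trans (hmax n (by simp))
  have hkm : kF < m := by
    by_contra! h
    have h1 := pos_le (hne _) (hsupp m)
    have h2 : (m : ℤ) * ρ ≤ kF * ρ := by gcongr
    linarith
  obtain ⟨s, hs, hlt⟩ := (hkF.2 _).1 _ (mem_Lset_pos (hne _) (hsupp m))
  rw [zIter_add hF] at hlt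
  rw [Finset.mem_range] at hm
  obtain ⟨q, hq⟩ := Int.eq_ofNat_of_zero_le (show 0 ≤ -(s + -(m : ℤ)) by omega)
  obtain hq : s + -(m : ℤ) = -(q : ℤ) := by omega
  rw [hq] at hlt
  rcases le_or_gt q n with hqn | hqn
  · exact (hmax q (Finset.mem_range.2 (by omega))).not_gt hlt
  · have hle := pos_le (m := k') (hne (-(q : ℤ))) fun j hj => by
      have := hlow (q - n) (by omega) j hj
      rwa [zIter_add hF, show -((q - n : ℕ) : ℤ) + -(n : ℤ) = -(q : ℤ) by omega] at this
    omega
end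

section
/- Let G be a finite group and let H be a normal subgroup of G. Let F be an injective group cellular automaton on G such that F(H^ℤ) ⊆ H^ℤ. Let F̄ : H^ℤ → H^ℤ be the restriction of F to H^ℤ, and let F̃ : (G/H)^ℤ → (G/H)^ℤ be defined by F̃([c]) = [F(c)], where [c] denotes the componentwise coset of c. Then F̄ and F̃ are well-defined injective group cellular automata on H and on G/H respectively, and F is expansive if and only if both F̃ and F̄ are expansive. -/
open Function Topology

theorem tychDist_le_zpow_iff {A : Type*} (c c' : ℤ → A) (M : ℕ) :
    tychDist c c' ≤ (2 : ℝ) ^ (-(M : ℤ)) ↔ ∀ j : ℤ, j.natAbs < M → c j = c' j := by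
  unfold tychDist
  split_ifs with h
  · subst h
    simp only [implies_true, iff_true]
    positivity
  · have hne : {n : ℕ | ∃ j : ℤ, j.natAbs = n ∧ c j ≠ c' j}.Nonempty := by
      obtain ⟨j, hj⟩ := Function.ne_iff.mp h
      exact ⟨_, j, rfl, hj⟩
    rw [zpow_le_zpow_iff_right₀ (by norm_num : (1 : ℝ) < 2), neg_le_neg_iff, Nat.cast_le]
    constructor
    · intro hM j hj
      by_contra hcj
      exact absurd (hM.trans (Nat.sInf_le ⟨j, rfl, hcj⟩)) (not_le.mpr hj)
    · intro hM
      obtain ⟨j, hj, hcj⟩ := Nat.sInf_mem hne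
      by_contra! hlt
      exact hcj (hM j (hj ▸ hlt))

theorem expansive_iff_exists_window {A : Type*} [Nonempty A] (F : (ℤ → A) → (ℤ → A)) :
    Expansive F ↔ ∃ M : ℕ, ∀ c c' : ℤ → A,
      (∀ (n j : ℤ), j.natAbs < M → zIter F n c j = zIter F n c' j) → c = c' := by
  constructor
  · rintro ⟨ε, hε, h⟩
    obtain ⟨M, hM⟩ := exists_pow_lt_of_lt_one hε (by norm_num : (1 / 2 : ℝ) < 1)
    refine ⟨M, fun c c' hc => ?_⟩
    by_contra hne
    obtain ⟨n, hn⟩ := h c c' hne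
    have h1 := (tychDist_le_zpow_iff _ _ M).mpr (hc n)
    have h2 : (2 : ℝ) ^ (-(M : ℤ)) = (1 / 2) ^ M := by simp
    linarith
  · rintro ⟨M, hM⟩
    refine ⟨(2 : ℝ) ^ (-(M : ℤ)), by positivity, fun c c' hne => ?_⟩
    by_contra! hle
    exact hne (hM c c' fun n => (tychDist_le_zpow_iff _ _ M).mp (hle n))

theorem zIter_mulAut {A : Type*} [Group A] (φ : MulAut (ℤ → A)) (n : ℤ) (c : ℤ → A) :
    zIter φ n c = (φ ^ n) c := by
  have hpow : ∀ (ψ : MulAut (ℤ → A)) (k : ℕ), (⇑ψ)^[k] = ⇑(ψ ^ k) := by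
    intro ψ k
    induction k with
    | zero => rfl
    | succ k ih => rw [Function.iterate_succ, ih, pow_succ]; rfl
  have hinv : Function.invFun φ = ⇑φ⁻¹ :=
    funext fun x => φ.injective <| by
      rw [Function.invFun_eq (φ.surjective x), MulAut.apply_inv_self]
  unfold zIter
  split_ifs with h
  · lift n to ℕ using h
    rw [hpow, Int.toNat_natCast, zpow_natCast]
  · obtain ⟨k, rfl⟩ : ∃ k : ℕ, n = -(k : ℤ) := ⟨(-n).toNat, by omega⟩
    rw [hinv, hpow, neg_neg, Int.toNat_natCast, zpow_neg, zpow_natCast, inv_pow]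

theorem expansive_mulAut_iff {A : Type*} [Group A] (φ : MulAut (ℤ → A)) :
    Expansive φ ↔ ∃ M : ℕ, ∀ c : ℤ → A,
      (∀ (n j : ℤ), j.natAbs < M → (φ ^ n) c j = 1) → c = 1 := by
  simp only [expansive_iff_exists_window, zIter_mulAut]
  constructor
  · rintro ⟨M, hM⟩
    exact ⟨M, fun c hc => hM c 1 fun n j hj => by rw [hc n j hj, map_one, Pi.one_apply]⟩
  · rintro ⟨M, hM⟩
    refine ⟨M, fun c c' hc => div_eq_one.mp (hM _ fun n j hj => ?_)⟩
    rw [map_div, Pi.div_apply, hc n j hj, div_self']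

theorem MulAut.zpow_semiconj {X Y : Type*} [Group X] [Group Y] {φ : MulAut X} {ψ : MulAut Y}
    {p : X → Y} (h : ∀ x, p (φ x) = ψ (p x)) (n : ℤ) (x : X) :
    p ((φ ^ n) x) = (ψ ^ n) (p x) := by
  have hnat : ∀ (k : ℕ) (x : X), p ((φ ^ k) x) = (ψ ^ k) (p x) := by
    intro k
    induction k with
    | zero => intro x; rfl
    | succ k ih =>
      intro x
      rw [pow_succ, pow_succ, MulAut.mul_apply, MulAut.mul_apply, ih, h]
  obtain ⟨k, rfl | rfl⟩ := n.eq_nat_or_neg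
  · rw [zpow_natCast, zpow_natCast, hnat]
  · apply (ψ ^ k).injective
    rw [← hnat, zpow_neg, zpow_natCast, zpow_neg, zpow_natCast, MulAut.apply_inv_self,
      MulAut.apply_inv_self]

theorem MulAut.continuous_zpow {X : Type*} [Group X] [TopologicalSpace X] [CompactSpace X]
    [T2Space X] {φ : MulAut X} (hφ : Continuous φ) (n : ℤ) : Continuous ⇑(φ ^ n) := by
  have hpow : ∀ (ψ : MulAut X), Continuous ψ → ∀ k : ℕ, Continuous ⇑(ψ ^ k) := by
    intro ψ hψ k
    induction k with
    | zero => exact continuous_id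
    | succ k ih => rw [pow_succ]; exact ih.comp hψ
  have hinv : Continuous ⇑φ⁻¹ :=
    Continuous.continuous_symm_of_equiv_compact_to_t2 (f := φ.toEquiv) hφ
  obtain ⟨k, rfl | rfl⟩ := n.eq_nat_or_neg
  · rw [zpow_natCast]; exact hpow φ hφ k
  · rw [zpow_neg, zpow_natCast, ← inv_pow]; exact hpow _ hinv k

/-- The elements whose forward orbit stays in `U` at all times `0 ≤ j < m`. -/
def forwardStay {X : Type*} [Group X] (φ : MulAut X) (U : Subgroup X) (m : ℕ) : Subgroup X where
  carrier := {x | ∀ j < m, (φ ^ (j : ℤ)) x ∈ U}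
  one_mem' := fun j _ => by rw [map_one]; exact U.one_mem
  mul_mem' := fun hx hy j hj => by rw [map_mul]; exact U.mul_mem (hx j hj) (hy j hj)
  inv_mem' := fun hx j hj => by rw [map_inv]; exact U.inv_mem (hx j hj)

theorem mem_forwardStay {X : Type*} [Group X] {φ : MulAut X} {U : Subgroup X} {m : ℕ} {x : X} :
    x ∈ forwardStay φ U m ↔ ∀ j < m, (φ ^ (j : ℤ)) x ∈ U := Iff.rfl

theorem isOpen_forwardStay {X : Type*} [Group X] [TopologicalSpace X] [CompactSpace X]
    [T2Space X] {φ : MulAut X} (hφ : Continuous φ) {U : Subgroup X} (hU : IsOpen (U : Set X))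
    (m : ℕ) : IsOpen (forwardStay φ U m : Set X) := by
  have : (forwardStay φ U m : Set X) = ⋂ j ∈ Finset.range m, ⇑(φ ^ (j : ℤ)) ⁻¹' U := by
    ext x
    simp [mem_forwardStay]
  rw [this]
  exact isOpen_biInter_finset fun j _ => hU.preimage (MulAut.continuous_zpow hφ j)

/-- The follower sets of the identity stabilise. -/
theorem exists_follower_stable {X : Type*} [Group X] (φ : MulAut X) (N U : Subgroup X)
    [Finite (X ⧸ U)] (hN : ∀ x ∈ N, φ x ∈ N) :
    ∃ k : ℕ, ∀ m, k ≤ m → ∀ z ∈ N, z ∈ forwardStay φ U k →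
      ∃ z' ∈ N, z' ∈ forwardStay φ U m ∧ ((φ ^ (m : ℤ)) z')⁻¹ * (φ ^ (k : ℤ)) z ∈ U := by
  let S : ℕ → Set (X ⧸ U) := fun n =>
    {q | ∃ z ∈ N, z ∈ forwardStay φ U n ∧ ((φ ^ (n : ℤ)) z : X ⧸ U) = q}
  have hS : Antitone S := by
    refine antitone_nat_of_succ_le fun n => ?_
    rintro q ⟨z, hzN, hz, rfl⟩
    have hstep : ∀ j : ℕ, (φ ^ (j : ℤ)) (φ z) = (φ ^ ((j + 1 : ℕ) : ℤ)) z := fun j => by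
      rw [Nat.cast_succ, zpow_add_one, MulAut.mul_apply]
    refine ⟨φ z, hN z hzN, fun j hj => ?_, by rw [hstep]⟩
    rw [hstep]
    exact hz (j + 1) (by omega)
  obtain ⟨k, hk⟩ := WellFoundedGT.monotone_chain_condition
    (⟨fun n => OrderDual.toDual (S n), fun _ _ h => hS h⟩ : ℕ →o (Set (X ⧸ U))ᵒᵈ)
  refine ⟨k, fun m hm z hzN hz => ?_⟩
  have hSm : S k = S m := hk m hm
  have hmem : ((φ ^ (k : ℤ)) z : X ⧸ U) ∈ S k := ⟨z, hzN, hz, rfl⟩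
  rw [hSm] at hmem
  obtain ⟨z', hz'N, hz', heq⟩ := hmem
  exact ⟨z', hz'N, hz', QuotientGroup.eq.mp heq⟩

/-- Group shifts are of finite type: an orbit that locally looks like orbits of `N` can be
followed by orbits of `N` over arbitrarily long times. -/
theorem exists_locally_determined {X : Type*} [Group X] (φ : MulAut X) (N U : Subgroup X)
    [Finite (X ⧸ U)] (hN : ∀ (n : ℤ), ∀ x ∈ N, (φ ^ n) x ∈ N) :
    ∃ k : ℕ, ∀ y : X, (∀ n : ℤ, ∃ a ∈ N, a⁻¹ * (φ ^ n) y ∈ forwardStay φ U k) →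
      ∀ (m : ℕ) (n : ℤ), ∃ a ∈ N, a⁻¹ * (φ ^ n) y ∈ forwardStay φ U m := by
  obtain ⟨k, hk⟩ := exists_follower_stable φ N U (by simpa using hN 1)
  refine ⟨k + 1, fun y hy m n => ?_⟩
  rcases le_total m (k + 1) with hm | hm
  · obtain ⟨a, ha, hay⟩ := hy n
    exact ⟨a, ha, fun j hj => hay j (hj.trans_le hm)⟩
  induction m, hm using Nat.le_induction with
  | base => exact hy n
  | succ m hm ih =>
    obtain ⟨x, hxN, hx⟩ := ih
    obtain ⟨d, rfl⟩ : ∃ d : ℕ, m = k + d := ⟨m - k, by omega⟩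
    obtain ⟨a, haN, ha⟩ := hy (d + n)
    obtain ⟨b, hbN, rfl⟩ : ∃ b ∈ N, (φ ^ (d : ℤ)) b = a :=
      ⟨(φ ^ (-d : ℤ)) a, hN _ a haN, by rw [← MulAut.mul_apply, ← zpow_add]; simp⟩
    have hcomp : ∀ (j : ℕ) (w : X),
        (φ ^ (j : ℤ)) ((φ ^ (d : ℤ)) w) = (φ ^ ((j + d : ℕ) : ℤ)) w := fun j w => by
      rw [← MulAut.mul_apply, ← zpow_add, Nat.cast_add]
    have hb : ∀ j < k + 1, (φ ^ ((j + d : ℕ) : ℤ)) (b⁻¹ * (φ ^ n) y) ∈ U := fun j hj => by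
      have := ha j hj
      rwa [zpow_add, MulAut.mul_apply, ← map_inv, ← map_mul, hcomp] at this
    have hxb : (x⁻¹ * b) = (x⁻¹ * (φ ^ n) y) * (b⁻¹ * (φ ^ n) y)⁻¹ := by group
    obtain ⟨z, hzN, hz, hzU⟩ := hk (k + d) (by omega) ((φ ^ (d : ℤ)) (x⁻¹ * b))
      (hN _ _ (N.mul_mem (N.inv_mem hxN) hbN)) (fun j hj => by
        rw [hcomp, hxb, map_mul, map_inv]
        exact U.mul_mem (hx _ (by omega)) (U.inv_mem (hb j (by omega))))
    refine ⟨x * z, N.mul_mem hxN hzN, fun j hj => ?_⟩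
    rcases Nat.lt_succ_iff_lt_or_eq.mp hj with hj | rfl
    · rw [mul_inv_rev, mul_assoc, map_mul, map_inv]
      exact U.mul_mem (U.inv_mem (hz j hj)) (hx j hj)
    · rw [hcomp] at hzU
      have hsplit : (x * z)⁻¹ * (φ ^ n) y = z⁻¹ * (x⁻¹ * b) * (b⁻¹ * (φ ^ n) y) := by group
      rw [hsplit, map_mul, map_mul, map_inv]
      exact U.mul_mem hzU (hb k (by omega))

/-- An expansive automorphism of a compact group, with expansivity witnessed by an open subgroup,
is expansive modulo every closed invariant subgroup. -/
theorem exists_open_expansive_mod {X : Type*} [Group X] [TopologicalSpace X]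
    [IsTopologicalGroup X] [CompactSpace X] [T2Space X] {φ : MulAut X} (hφ : Continuous φ)
    {N U : Subgroup X} (hNc : IsClosed (N : Set X)) (hU : IsOpen (U : Set X))
    (hN : ∀ (n : ℤ), ∀ x ∈ N, (φ ^ n) x ∈ N) (hexp : ∀ x, (∀ n : ℤ, (φ ^ n) x ∈ U) → x = 1) :
    ∃ W : Subgroup X, IsOpen (W : Set X) ∧
      ∀ y : X, (∀ n : ℤ, ∃ a ∈ N, a⁻¹ * (φ ^ n) y ∈ W) → y ∈ N := by
  have : Finite (X ⧸ U) := U.quotient_finite_of_isOpen hU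
  obtain ⟨k, hk⟩ := exists_locally_determined φ N U hN
  refine ⟨forwardStay φ U k, isOpen_forwardStay hφ hU k, fun y hy => ?_⟩
  let K : ℕ → Set X := fun m =>
    {p | p ∈ N ∧ ∀ j : ℤ, j.natAbs < m → (φ ^ j) (p⁻¹ * y) ∈ U}
  have hKc : ∀ m, IsClosed (K m) := fun m => by
    have hset : K m = (N : Set X) ∩ ⋂ j : ℤ, ⋂ (_ : j.natAbs < m),
        (fun p : X => (φ ^ j) (p⁻¹ * y)) ⁻¹' (U : Set X) := by
      ext p
      simp [K]
    rw [hset]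
    refine hNc.inter (isClosed_iInter fun j => isClosed_iInter fun _ => ?_)
    exact (U.isClosed_of_isOpen hU).preimage
      ((MulAut.continuous_zpow hφ j).comp (continuous_inv.mul continuous_const))
  have hKne : ∀ m, (K m).Nonempty := fun m => by
    obtain ⟨a, haN, ha⟩ := hk y hy (2 * m) (-m)
    refine ⟨(φ ^ (m : ℤ)) a, hN _ a haN, fun j hj => ?_⟩
    have h := ha (j + m).toNat (by omega)
    have hcancel : (φ ^ (m : ℤ)) ((φ ^ (-m : ℤ)) y) = y := by
      rw [← MulAut.mul_apply, ← zpow_add, add_neg_cancel, zpow_zero, MulAut.one_apply]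
    rwa [Int.toNat_of_nonneg (by omega), zpow_add, MulAut.mul_apply, map_mul (φ ^ (m : ℤ)),
      map_inv, hcancel] at h
  obtain ⟨p, hp⟩ := IsCompact.nonempty_iInter_of_sequence_nonempty_isCompact_isClosed K
    (fun m p hp => ⟨hp.1, fun j hj => hp.2 j (by omega)⟩) hKne (hKc 0).isCompact hKc
  rw [Set.mem_iInter] at hp
  have h1 : p⁻¹ * y = 1 := hexp _ fun n => (hp (n.natAbs + 1)).2 n (by omega)
  rw [← inv_mul_eq_one.mp h1]
  exact (hp 0).1

/-- An injective cellular automaton over a finite alphabet is surjective. -/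
theorem surjective_of_injective_cellularAutomaton {A : Type*} [Finite A]
    {F : (ℤ → A) → (ℤ → A)} (hcont : Continuous[configTop A, configTop A] F)
    (hshift : F ∘ shiftMap A = shiftMap A ∘ F) (hinj : Function.Injective F) :
    Function.Surjective F := by
  let : TopologicalSpace A := ⊥
  have : DiscreteTopology A := ⟨rfl⟩
  have hc : Continuous F := hcont
  have hshift_nat : ∀ (p : ℕ) (c : ℤ → A), F (fun i => c (i + p)) = fun i => F c (i + p) := by
    intro p
    induction p with
    | zero => simp
    | succ p ih =>
      intro c
      have h1 : F (fun i => c (i + 1 + p)) = fun i => F (fun i => c (i + p)) (i + 1) :=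
        congrFun hshift fun i => c (i + p)
      rw [ih] at h1
      simpa only [Nat.cast_succ, add_assoc, add_comm (1 : ℤ)] using h1
  let P : ℕ → Set (ℤ → A) := fun p => {c | ∀ i, c (i + p) = c i}
  have hmod : ∀ (p : ℕ), ∀ c ∈ P p, ∀ i : ℤ, c (i % p) = c i := by
    intro p c hcP i
    have hper : Function.Periodic c (p : ℤ) := hcP
    have h := hper.int_mul (i / p) (i % p)
    rw [← h, mul_comm]
    congr 1
    exact Int.emod_add_mul_ediv i p
  have hPfin : ∀ p : ℕ, 0 < p → (P p).Finite := by
    intro p hp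
    refine Set.Finite.of_finite_image
      (f := fun (c : ℤ → A) (i : Fin p) => c i) (Set.toFinite _) ?_
    intro c hcP c' hcP' h
    funext i
    rw [← hmod p c hcP i, ← hmod p c' hcP' i]
    have hp' : (0 : ℤ) < p := by exact_mod_cast hp
    have hnn := Int.emod_nonneg i hp'.ne'
    have hlt := Int.emod_lt_of_pos i hp'
    have := congrFun h ⟨(i % p).toNat, by omega⟩
    simpa [Int.toNat_of_nonneg hnn] using this
  have hPrange : ∀ p : ℕ, 0 < p → P p ⊆ Set.range F := by
    intro p hp y hy
    have hmaps : Set.MapsTo F (P p) (P p) := fun c hcP i => by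
      have h := congrFun (hshift_nat p c) i
      rw [← h]
      exact congrFun (congrArg F (funext hcP)) i
    have := (hPfin p hp).to_subtype
    obtain ⟨x, hx⟩ := Finite.surjective_of_injective
      ((Set.MapsTo.restrict_inj hmaps).mpr hinj.injOn) ⟨y, hy⟩
    exact ⟨x, congrArg Subtype.val hx⟩
  intro y
  let u : ℕ → ℤ → A := fun m i => y ((i + m) % ((2 * m + 1 : ℕ) : ℤ) - m)
  have hu : Filter.Tendsto u Filter.atTop (𝓝 y) := by
    refine tendsto_pi_nhds.mpr fun i => ?_
    refine tendsto_const_nhds.congr' ?_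
    filter_upwards [Filter.eventually_ge_atTop i.natAbs] with m hm
    simp only [u]
    rw [Int.emod_eq_of_lt (by omega) (by push_cast; omega), add_sub_cancel_right]
  refine (isCompact_range hc).isClosed.mem_of_tendsto hu (Filter.Eventually.of_forall fun m => ?_)
  refine hPrange (2 * m + 1) (by omega) fun i => ?_
  simp only [u]
  rw [add_right_comm, Int.add_emod_right]

theorem continuous_configTop_map {A B : Type*} (f : A → B) :
    Continuous[configTop A, configTop B] fun c i => f (c i) := by
  let : TopologicalSpace A := ⊥
  let : TopologicalSpace B := ⊥
  have : DiscreteTopology A := ⟨rfl⟩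
  have : Continuous fun (c : ℤ → A) i => f (c i) :=
    continuous_pi fun i => continuous_of_discreteTopology.comp (continuous_apply i)
  exact this

theorem exists_window_of_isOpen {A : Type*} [Group A] [TopologicalSpace A]
    {W : Subgroup (ℤ → A)} (hW : IsOpen (W : Set (ℤ → A))) :
    ∃ M : ℕ, ∀ c : ℤ → A, (∀ j : ℤ, j.natAbs < M → c j = 1) → c ∈ W := by
  obtain ⟨I, u, hu, hI⟩ := isOpen_pi_iff.mp hW 1 W.one_mem
  refine ⟨I.sup Int.natAbs + 1, fun c hc => hI fun j hj => ?_⟩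
  rw [hc j (Nat.lt_succ_of_le (Finset.le_sup (f := Int.natAbs) hj))]
  exact (hu j hj).2

/-- The subgroup of configurations that are trivial at all `j` with `|j| < M`. -/
def windowSubgroup (A : Type*) [Group A] (M : ℕ) : Subgroup (ℤ → A) :=
  Subgroup.pi {j : ℤ | j.natAbs < M} fun _ => ⊥

theorem mem_windowSubgroup {A : Type*} [Group A] {M : ℕ} {c : ℤ → A} :
    c ∈ windowSubgroup A M ↔ ∀ j : ℤ, j.natAbs < M → c j = 1 := by
  simp [windowSubgroup, Subgroup.mem_pi]

/-- Expansivity passes to the quotient by an invariant full shift `H^ℤ`. -/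
theorem exists_window_mod_subgroup {A : Type*} [Group A] [Finite A] (H : Subgroup A)
    {φ : MulAut (ℤ → A)} (hφ : Continuous[configTop A, configTop A] φ)
    (hH : ∀ (n : ℤ) (c : ℤ → A), (∀ i, c i ∈ H) → ∀ i, (φ ^ n) c i ∈ H)
    (hexp : Expansive φ) :
    ∃ M : ℕ, ∀ c : ℤ → A,
      (∀ n j : ℤ, j.natAbs < M → (φ ^ n) c j ∈ H) → ∀ i, c i ∈ H := by
  classical
  let : TopologicalSpace A := ⊥
  have : DiscreteTopology A := ⟨rfl⟩
  have hc : Continuous φ := hφ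
  obtain ⟨M, hM⟩ := (expansive_mulAut_iff φ).mp hexp
  have hNmem : ∀ c : ℤ → A, c ∈ Subgroup.pi Set.univ (fun _ : ℤ => H) ↔ ∀ i, c i ∈ H :=
    fun c => by simp [Subgroup.mem_pi]
  obtain ⟨W, hW, hWN⟩ := exists_open_expansive_mod (N := Subgroup.pi Set.univ fun _ : ℤ => H)
    (U := windowSubgroup A M) hc
    (isClosed_set_pi fun _ _ => isClosed_discrete _)
    (isOpen_set_pi (Set.Finite.subset (Set.finite_Icc (-M : ℤ) M)
      fun j (hj : j.natAbs < M) => ⟨by omega, by omega⟩) fun _ _ => isOpen_discrete _)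
    (fun n x hx => (hNmem _).mpr (hH n x ((hNmem x).mp hx)))
    (fun x hx => hM x fun n => mem_windowSubgroup.mp (hx n))
  obtain ⟨L, hL⟩ := exists_window_of_isOpen hW
  refine ⟨L, fun c hcH => (hNmem c).mp (hWN c fun n => ?_)⟩
  refine ⟨fun j => if j.natAbs < L then (φ ^ n) c j else 1, (hNmem _).mpr fun j => ?_,
    hL _ fun j hj => ?_⟩
  · split_ifs with hj
    · exact hcH n j hj
    · exact H.one_mem
  · simp [hj]

/-- The automorphism of the configuration group given by a bijective endomorphism. -/
noncomputable def configAut {A : Type*} [Group A] (F : (ℤ → A) → (ℤ → A))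
    (hhom : ∀ c c' : ℤ → A, F (c * c') = F c * F c') (hF : Function.Bijective F) :
    MulAut (ℤ → A) :=
  MulEquiv.ofBijective (MonoidHom.mk' F hhom) hF

/-- for `H ⊴ G` with `F(H^ℤ) ⊆ H^ℤ`, the restriction `F̄` and the quotient map
`F̃` are well-defined injective GCAs, and `F` is expansive iff both `F̃` and `F̄` are. -/
theorem expansive_iff_quotient_and_restriction {G : Type*} [Group G] [Fintype G]
    (H : Subgroup G) [H.Normal]
    (F : (ℤ → G) → (ℤ → G))
    (hcont : Continuous[configTop G, configTop G] F)
    (hshift : F ∘ shiftMap G = shiftMap G ∘ F)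
    (hhom : ∀ c c' : ℤ → G, F (c * c') = F c * F c')
    (hinj : Function.Injective F)
    (hH : ∀ c : ℤ → G, (∀ i, c i ∈ H) → ∀ i, F c i ∈ H) :
    ∃ (Fbar : (ℤ → H) → (ℤ → H)) (Ftilde : (ℤ → G ⧸ H) → (ℤ → G ⧸ H)),
      (∀ (c : ℤ → H) (i : ℤ), (Fbar c i : G) = F (fun j => (c j : G)) i) ∧
      (∀ (c : ℤ → G) (i : ℤ),
        Ftilde (fun j => QuotientGroup.mk (c j)) i = QuotientGroup.mk (F c i)) ∧
      Function.Injective Fbar ∧ Function.Injective Ftilde ∧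
      Continuous[configTop H, configTop H] Fbar ∧
      Continuous[configTop (G ⧸ H), configTop (G ⧸ H)] Ftilde ∧
      Fbar ∘ shiftMap H = shiftMap H ∘ Fbar ∧
      Ftilde ∘ shiftMap (G ⧸ H) = shiftMap (G ⧸ H) ∘ Ftilde ∧
      (∀ c c' : ℤ → H, Fbar (c * c') = Fbar c * Fbar c') ∧
      (∀ c c' : ℤ → G ⧸ H, Ftilde (c * c') = Ftilde c * Ftilde c') ∧
      (Expansive F ↔ (Expansive Ftilde ∧ Expansive Fbar)) := by
  classical
  let Fbar : (ℤ → H) → (ℤ → H) := fun c i =>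
    ⟨F (fun j => (c j : G)) i, hH _ (fun j => (c j).2) i⟩
  let Ftilde : (ℤ → G ⧸ H) → (ℤ → G ⧸ H) := fun c i => QuotientGroup.mk (F (fun j => (c j).out) i)
  have hFbar : ∀ (c : ℤ → H) (i : ℤ), (Fbar c i : G) = F (fun j => (c j : G)) i :=
    fun _ _ => rfl
  have hFinv : ∀ c, F c⁻¹ = (F c)⁻¹ := fun c => map_inv (MonoidHom.mk' F hhom) c
  have hFtilde : ∀ (c : ℤ → G) (i : ℤ),
      Ftilde (fun j => QuotientGroup.mk (c j)) i = QuotientGroup.mk (F c i) := by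
    intro c i
    refine QuotientGroup.eq.mpr ?_
    have h := hH ((fun j => (QuotientGroup.mk (c j) : G ⧸ H).out)⁻¹ * c)
      (fun j => QuotientGroup.eq.mp (QuotientGroup.out_eq' _)) i
    rwa [hhom, hFinv] at h
  have hlift : ∀ c : ℤ → G ⧸ H, ∃ g : ℤ → G, c = fun j => QuotientGroup.mk (g j) :=
    fun c => ⟨fun j => (c j).out, funext fun j => (QuotientGroup.out_eq' _).symm⟩
  have hbar_inj : Function.Injective Fbar := fun c c' h => funext fun i => Subtype.ext <|
    congrFun (hinj (funext fun j => congrArg Subtype.val (congrFun h j)) :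
      (fun j => (c j : G)) = fun j => (c' j : G)) i
  have hbar_cont : Continuous[configTop H, configTop H] Fbar := by
    have h1 := continuous_configTop_map (Subtype.val : H → G)
    have h2 := continuous_configTop_map fun g : G => if hg : g ∈ H then (⟨g, hg⟩ : H) else 1
    have h3 := @Continuous.comp _ _ _ (configTop H) (configTop G) (configTop H) _ _ h2
      (@Continuous.comp _ _ _ (configTop H) (configTop G) (configTop G) _ _ hcont h1)
    convert h3 using 1
    funext c i
    exact (dif_pos (hH _ (fun j => (c j).2) i)).symm
  have htilde_cont : Continuous[configTop (G ⧸ H), configTop (G ⧸ H)] Ftilde :=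
    @Continuous.comp _ _ _ (configTop (G ⧸ H)) (configTop G) (configTop (G ⧸ H)) _ _
      (continuous_configTop_map (QuotientGroup.mk : G → G ⧸ H))
      (@Continuous.comp _ _ _ (configTop (G ⧸ H)) (configTop G) (configTop G) _ _ hcont
        (continuous_configTop_map (Quotient.out : G ⧸ H → G)))
  have hbar_shift : Fbar ∘ shiftMap H = shiftMap H ∘ Fbar :=
    funext fun c => funext fun i => Subtype.ext
      (congrFun (congrFun hshift fun j => (c j : G)) i)
  have htilde_shift : Ftilde ∘ shiftMap (G ⧸ H) = shiftMap (G ⧸ H) ∘ Ftilde :=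
    funext fun c => funext fun i => congrArg QuotientGroup.mk
      (congrFun (congrFun hshift fun j => (c j).out) i)
  have hbar_hom : ∀ c c' : ℤ → H, Fbar (c * c') = Fbar c * Fbar c' := fun c c' =>
    funext fun i => Subtype.ext
      (congrFun (hhom (fun j => (c j : G)) fun j => (c' j : G)) i)
  have htilde_hom : ∀ c c' : ℤ → G ⧸ H, Ftilde (c * c') = Ftilde c * Ftilde c' := by
    intro c c'
    obtain ⟨g, rfl⟩ := hlift c
    obtain ⟨g', rfl⟩ := hlift c'
    funext i
    have h := hFtilde (g * g') i
    rw [hhom] at h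
    rw [Pi.mul_apply, hFtilde, hFtilde]
    exact h
  have hsurj := surjective_of_injective_cellularAutomaton hcont hshift hinj
  have hbar_surj := surjective_of_injective_cellularAutomaton hbar_cont hbar_shift hbar_inj
  have hH_of : ∀ c : ℤ → G, (∀ i, F c i ∈ H) → ∀ i, c i ∈ H := by
    intro c hc
    obtain ⟨h, hh⟩ := hbar_surj fun i => ⟨F c i, hc i⟩
    have hFh : F (fun j => (h j : G)) = F c :=
      funext fun i => congrArg Subtype.val (congrFun hh i)
    rw [← hinj hFh]
    exact fun i => (h i).2
  have htilde_inj : Function.Injective Ftilde := by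
    intro c c' h
    obtain ⟨g, rfl⟩ := hlift c
    obtain ⟨g', rfl⟩ := hlift c'
    have hmem := hH_of (g⁻¹ * g') fun i => by
      have hi := congrFun h i
      rw [hFtilde, hFtilde] at hi
      rw [hhom, hFinv]
      exact QuotientGroup.eq.mp hi
    exact funext fun i => QuotientGroup.eq.mpr (hmem i)
  have htilde_surj : Function.Surjective Ftilde := by
    intro c
    obtain ⟨g, rfl⟩ := hlift c
    obtain ⟨g', rfl⟩ := hsurj g
    exact ⟨_, funext (hFtilde g')⟩
  refine ⟨Fbar, Ftilde, hFbar, hFtilde, hbar_inj, htilde_inj, hbar_cont, htilde_cont, hbar_shift,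
    htilde_shift, hbar_hom, htilde_hom, ?_⟩
  let φ := configAut F hhom ⟨hinj, hsurj⟩
  let φbar := configAut Fbar hbar_hom ⟨hbar_inj, hbar_surj⟩
  let φtilde := configAut Ftilde htilde_hom ⟨htilde_inj, htilde_surj⟩
  have hbar_zpow : ∀ (n : ℤ) (c : ℤ → H) (i : ℤ),
      ((φbar ^ n) c i : G) = (φ ^ n) (fun j => (c j : G)) i := fun n c =>
    congrFun (MulAut.zpow_semiconj (φ := φbar) (ψ := φ) (p := fun (c : ℤ → H) i => (c i : G))
      (fun _ => rfl) n c)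
  have htilde_zpow : ∀ (n : ℤ) (c : ℤ → G) (i : ℤ),
      (φtilde ^ n) (fun j => QuotientGroup.mk (c j)) i = QuotientGroup.mk ((φ ^ n) c i) :=
    fun n c i => (congrFun (MulAut.zpow_semiconj (φ := φ) (ψ := φtilde)
      (p := fun (c : ℤ → G) i => (QuotientGroup.mk (c i) : G ⧸ H))
      (fun c => (funext (hFtilde c)).symm) n c) i).symm
  change Expansive φ ↔ Expansive φtilde ∧ Expansive φbar
  constructor
  · intro hexp
    constructor
    · obtain ⟨M, hM⟩ := exists_window_mod_subgroup H (φ := φ) hcont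
        (fun n c hc i => hbar_zpow n (fun j => ⟨c j, hc j⟩) i ▸ Subtype.prop _) hexp
      refine (expansive_mulAut_iff φtilde).mpr ⟨M, fun c hc => ?_⟩
      obtain ⟨g, rfl⟩ := hlift c
      refine funext fun i => (QuotientGroup.eq_one_iff _).mpr (hM g (fun n j hj => ?_) i)
      rw [← QuotientGroup.eq_one_iff, ← htilde_zpow]
      exact hc n j hj
    · obtain ⟨M, hM⟩ := (expansive_mulAut_iff φ).mp hexp
      refine (expansive_mulAut_iff φbar).mpr ⟨M, fun c hc => ?_⟩
      have h1 := hM (fun j => (c j : G)) fun n j hj => by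
        rw [← hbar_zpow, hc n j hj, Subgroup.coe_one]
      exact funext fun i => Subtype.ext (congrFun h1 i)
  · rintro ⟨htilde, hbar⟩
    obtain ⟨M, hM⟩ := (expansive_mulAut_iff φtilde).mp htilde
    obtain ⟨L, hL⟩ := (expansive_mulAut_iff φbar).mp hbar
    refine (expansive_mulAut_iff φ).mpr ⟨max M L, fun c hc => ?_⟩
    have hcH : ∀ i, c i ∈ H := fun i => (QuotientGroup.eq_one_iff _).mp <|
      congrFun (hM (fun j => QuotientGroup.mk (c j)) fun n j hj => by
        rw [htilde_zpow, hc n j (lt_max_of_lt_left hj), QuotientGroup.mk_one]) i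
    have h1 := hL (fun i => ⟨c i, hcH i⟩) fun n j hj => Subtype.ext <| by
      rw [hbar_zpow]
      exact hc n j (lt_max_of_lt_right hj)
    exact funext fun i => congrArg Subtype.val (congrFun h1 i)
end
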